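/- Let b = ρΦ ∈ C¹_♯(Y_d)^d, where ρ ∈ C¹_♯(Y_d) is nonnegative, not identically zero, and vanishes at some point, and Φ ∈ C¹_♯(Y_d)^d vanishes nowhere; let (ρ_n) ⊂ C¹_♯(Y_d) be positive with ρ ≤ ρ_n, ρ_n → ρ uniformly, and with rotation set of ρ_nΦ a singleton for each n. Assume there exists a positive σ ∈ C¹_♯(Y_d) such that σΦ is divergence free in ℝ^d. If ∫_{Y_d} σ(y)/ρ(y) dy = ∞ (i.e., the harmonic mean of ρ/σ is 0), then for every x ∈ ℝ^d, X(t,x)/t → 0 as t → ∞. -/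

import Mathlib

open MeasureTheory Filter Matrix

noncomputable section

/-- A function on `ℝ^d` is `ℤ^d`-periodic. -/
def ZdPeriodic {d : ℕ} {E : Type*} (f : (Fin d → ℝ) → E) : Prop :=
  ∀ (κ : Fin d → ℤ) (x : Fin d → ℝ), f (x + fun i => (κ i : ℝ)) = f x

/-- The unit cube `[0,1)^d`, a fundamental domain for the torus `Y_d = ℝ^d/ℤ^d`. -/
def unitCube (d : ℕ) : Set (Fin d → ℝ) := {x | ∀ i, x i ∈ Set.Ico (0 : ℝ) 1}

/-- `X` is the global flow of the vector field `b`: `∂X/∂t(t,x) = b(X(t,x))`, `X(0,x) = x`. -/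
def IsFlowOf {d : ℕ} (b : (Fin d → ℝ) → (Fin d → ℝ))
    (X : ℝ → (Fin d → ℝ) → (Fin d → ℝ)) : Prop :=
  ∀ x : Fin d → ℝ, X 0 x = x ∧ ∀ t : ℝ, HasDerivAt (fun s => X s x) (b (X t x)) t

/-- A measure `μ` on the torus `Y_d` (identified with a measure on `ℝ^d` carried by the unit
cube) is invariant for the flow `X`: `∫ ψ(X(t,y)) dμ = ∫ ψ dμ` for all `t` and all continuous
`ℤ^d`-periodic `ψ`. -/
def FlowInvariant {d : ℕ} (X : ℝ → (Fin d → ℝ) → (Fin d → ℝ))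
    (μ : Measure (Fin d → ℝ)) : Prop :=
  ∀ (t : ℝ) (ψ : (Fin d → ℝ) → ℝ), Continuous ψ → ZdPeriodic ψ →
    ∫ y, ψ (X t y) ∂μ = ∫ y, ψ y ∂μ

/-- Herman's rotation set `C_b = {∫ b dμ : μ invariant probability measure for the flow}`. -/
def rotationSet {d : ℕ} (b : (Fin d → ℝ) → (Fin d → ℝ))
    (X : ℝ → (Fin d → ℝ) → (Fin d → ℝ)) : Set (Fin d → ℝ) :=
  {ζ | ∃ μ : Measure (Fin d → ℝ), IsProbabilityMeasure μ ∧ μ (unitCube d)ᶜ = 0 ∧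
        FlowInvariant X μ ∧ ζ = ∫ y, b y ∂μ}

/-- The gradient of a scalar function on `ℝ^d`. -/
def grad {d : ℕ} (ψ : (Fin d → ℝ) → ℝ) (y : Fin d → ℝ) : Fin d → ℝ :=
  fun i => fderiv ℝ ψ y (Pi.single i 1)

section PeriodicFunctions

variable {d : ℕ} {E F : Type*}

theorem ZdPeriodic.exists_mem_unitCube {f : (Fin d → ℝ) → E} (hf : ZdPeriodic f)
    (x : Fin d → ℝ) : ∃ y ∈ unitCube d, f y = f x := by
  refine ⟨fun i => Int.fract (x i), fun i => ⟨Int.fract_nonneg _, Int.fract_lt_one _⟩, ?_⟩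
  rw [← hf (fun i => ⌊x i⌋)]
  congr 1
  ext i
  simp [Int.fract_add_floor]

theorem unitCube_eq_pi (d : ℕ) :
    unitCube d = Set.pi Set.univ fun _ : Fin d => Set.Ico (0 : ℝ) 1 := by
  ext; simp [unitCube]

theorem measurableSet_unitCube (d : ℕ) : MeasurableSet (unitCube d) := by
  rw [unitCube_eq_pi]
  exact MeasurableSet.univ_pi fun _ => measurableSet_Ico

theorem volume_unitCube (d : ℕ) : volume (unitCube d) = 1 := by
  simp [unitCube_eq_pi, volume_pi_pi]

instance (d : ℕ) : IsProbabilityMeasure ((volume : Measure (Fin d → ℝ)).restrict (unitCube d)) :=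
  ⟨by simp [volume_unitCube]⟩

theorem unitCube_subset_Icc (d : ℕ) : unitCube d ⊆ Set.Icc 0 1 :=
  fun _ hx => ⟨fun i => (hx i).1, fun i => (hx i).2.le⟩

theorem ZdPeriodic.exists_norm_le [SeminormedAddCommGroup E] {f : (Fin d → ℝ) → E}
    (hf : ZdPeriodic f) (hc : Continuous f) : ∃ C, 0 ≤ C ∧ ∀ x, ‖f x‖ ≤ C := by
  obtain ⟨C, hC⟩ := (isCompact_Icc (a := (0 : Fin d → ℝ)) (b := 1)).exists_bound_of_continuousOn
    hc.continuousOn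
  have key : ∀ x, ‖f x‖ ≤ C := fun x => by
    obtain ⟨y, hy, hyx⟩ := hf.exists_mem_unitCube x
    exact hyx ▸ hC y (unitCube_subset_Icc d hy)
  exact ⟨C, (norm_nonneg _).trans (key 0), key⟩

theorem ZdPeriodic.fderiv [NormedAddCommGroup E] [NormedSpace ℝ E] {f : (Fin d → ℝ) → E}
    (hf : ZdPeriodic f) : ZdPeriodic (fderiv ℝ f) := fun κ x => by
  rw [← fderiv_comp_add_right]
  congr 1
  ext y : 1
  exact hf κ y

theorem ZdPeriodic.exists_lipschitzWith [NormedAddCommGroup E] [NormedSpace ℝ E]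
    {f : (Fin d → ℝ) → E} (hf : ZdPeriodic f) (hc : ContDiff ℝ 1 f) :
    ∃ K, LipschitzWith K f := by
  obtain ⟨C, hC0, hC⟩ := hf.fderiv.exists_norm_le (hc.continuous_fderiv one_ne_zero)
  exact ⟨⟨C, hC0⟩, lipschitzWith_of_nnnorm_fderiv_le (hc.differentiable one_ne_zero) hC⟩

theorem ZdPeriodic.smul [SMul E F] {f : (Fin d → ℝ) → E} {g : (Fin d → ℝ) → F}
    (hf : ZdPeriodic f) (hg : ZdPeriodic g) : ZdPeriodic fun y => f y • g y :=
  fun κ x => by simp only [hf κ x, hg κ x]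

theorem ZdPeriodic.mul [Mul E] {f g : (Fin d → ℝ) → E}
    (hf : ZdPeriodic f) (hg : ZdPeriodic g) : ZdPeriodic fun y => f y * g y :=
  fun κ x => by simp only [hf κ x, hg κ x]

theorem ZdPeriodic.apply {f : (Fin d → ℝ) → (Fin d → E)} (hf : ZdPeriodic f) (i : Fin d) :
    ZdPeriodic fun y => f y i :=
  fun κ x => by simp only [hf κ x]

theorem lipschitzWith_mul_of_bounded [PseudoMetricSpace E] {f g : E → ℝ} {Kf Kg : NNReal}
    {Cf Cg : ℝ} (hf : LipschitzWith Kf f) (hg : LipschitzWith Kg g)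
    (hCf : ∀ x, ‖f x‖ ≤ Cf) (hCg : ∀ x, ‖g x‖ ≤ Cg) :
    ∃ K, LipschitzWith K fun x => f x * g x := by
  refine ⟨(Cf * Kg + Kf * Cg).toNNReal, LipschitzWith.of_dist_le_mul fun x y => ?_⟩
  have h1 := hf.dist_le_mul x y
  have h2 := hg.dist_le_mul x y
  rw [Real.dist_eq] at h1 h2 ⊢
  have hx := hCf x
  have hy := hCg y
  rw [Real.norm_eq_abs] at hx hy
  calc |f x * g x - f y * g y| = |f x * (g x - g y) + (f x - f y) * g y| := by ring_nf
    _ ≤ |f x| * |g x - g y| + |f x - f y| * |g y| := by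
        rw [← abs_mul, ← abs_mul]; exact abs_add_le _ _
    _ ≤ Cf * (Kg * dist x y) + Kf * dist x y * Cg := by gcongr; exact (abs_nonneg _).trans hx
    _ = (Cf * Kg + Kf * Cg) * dist x y := by ring
    _ ≤ _ := by gcongr; exact Real.le_coe_toNNReal _

/-- The integral of a periodic function over the unit cube is translation invariant. -/
theorem ZdPeriodic.setIntegral_add_right [NormedAddCommGroup E] [NormedSpace ℝ E]
    {f : (Fin d → ℝ) → E} (hf : ZdPeriodic f) (v : Fin d → ℝ) :
    ∫ y in unitCube d, f (y + v) = ∫ y in unitCube d, f y := by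
  have hdom := ZSpan.isAddFundamentalDomain' (Pi.basisFun ℝ (Fin d)) volume
  rw [ZSpan.fundamentalDomain_pi_basisFun, ← unitCube_eq_pi] at hdom
  have : Countable (Submodule.span ℤ (Set.range (Pi.basisFun ℝ (Fin d)))).toAddSubgroup :=
    inferInstanceAs (Countable (Submodule.span ℤ (Set.range (Pi.basisFun ℝ (Fin d)))))
  have h := (hdom.vadd_of_comm v).setIntegral_eq hdom (f := f) (fun g x => by
    have hg := (Pi.basisFun ℝ (Fin d)).mem_span_iff_repr_mem ℤ (g : Fin d → ℝ)
    choose κ hκ using hg.1 g.2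
    have : (g : Fin d → ℝ) = fun i => (κ i : ℝ) := by
      ext i; simpa using (hκ i).symm
    rw [AddSubgroup.vadd_def, vadd_eq_add, add_comm, this, hf κ x])
  rw [← h, ← Set.image_vadd]
  have := (measurePreserving_vadd v (volume : Measure (Fin d → ℝ))).setIntegral_image_emb
    (measurableEmbedding_const_vadd v) f (unitCube d)
  simpa [add_comm] using this.symm

end PeriodicFunctions

section Flows

variable {d : ℕ} {b : (Fin d → ℝ) → (Fin d → ℝ)} {X : ℝ → (Fin d → ℝ) → (Fin d → ℝ)}

theorem IsFlowOf.neg (hX : IsFlowOf b X) : IsFlowOf (fun y => -b y) (fun t => X (-t)) := by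
  refine fun x => ⟨by simpa using (hX x).1, fun t => ?_⟩
  simpa [Function.comp_def] using ((hX x).2 (-t)).scomp t (hasDerivAt_neg t)

theorem IsFlowOf.eq_of_hasDerivAt {K : NNReal} (hX : IsFlowOf b X) (hb : LipschitzWith K b)
    {Y : ℝ → (Fin d → ℝ)} (hY : ∀ t, HasDerivAt Y (b (Y t)) t) (t : ℝ) : Y t = X t (Y 0) := by
  refine congrFun (ODE_solution_unique_univ (v := fun _ => b) (s := fun _ => Set.univ) (t₀ := 0)
    (fun _ => hb.lipschitzOnWith) (fun t => ⟨hY t, trivial⟩)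
    (fun t => ⟨(hX (Y 0)).2 t, trivial⟩) (hX _).1.symm) t

theorem IsFlowOf.map_add {K : NNReal} (hX : IsFlowOf b X) (hb : LipschitzWith K b)
    (t s : ℝ) (x : Fin d → ℝ) : X (t + s) x = X t (X s x) := by
  have h := hX.eq_of_hasDerivAt hb (Y := fun r => X (r + s) x)
    (fun r => ((hX x).2 (r + s)).comp_add_const r s) t
  simpa using h

theorem IsFlowOf.map_add_int {K : NNReal} (hX : IsFlowOf b X) (hb : LipschitzWith K b)
    (hper : ZdPeriodic b) (t : ℝ) (κ : Fin d → ℤ) (x : Fin d → ℝ) :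
    X t (x + fun i => (κ i : ℝ)) = X t x + fun i => (κ i : ℝ) := by
  have h := hX.eq_of_hasDerivAt hb (Y := fun r => X r x + fun i => (κ i : ℝ))
    (fun r => by simpa only [hper κ] using ((hX x).2 r).add_const _) t
  simpa [(hX x).1] using h.symm

theorem IsFlowOf.lipschitzWith {K : NNReal} (hX : IsFlowOf b X) (hb : LipschitzWith K b)
    (t : ℝ) : ∃ C, LipschitzWith C (X t) := by
  have nonneg : ∀ (c : (Fin d → ℝ) → (Fin d → ℝ)) (Z : ℝ → (Fin d → ℝ) → (Fin d → ℝ)),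
      LipschitzWith K c → IsFlowOf c Z → ∀ t, 0 ≤ t → ∃ C, LipschitzWith C (Z t) := by
    intro c Z hc hZ t ht
    refine ⟨(Real.exp (K * (t - 0))).toNNReal, LipschitzWith.of_dist_le_mul fun x y => ?_⟩
    rw [Real.coe_toNNReal _ (Real.exp_pos _).le, mul_comm]
    refine dist_le_of_trajectories_ODE (v := fun _ => c) (f := fun s => Z s x)
      (g := fun s => Z s y) (fun _ => hc)
      (fun s _ => ((hZ x).2 s).continuousAt.continuousWithinAt)
      (fun s _ => ((hZ x).2 s).hasDerivWithinAt)
      (fun s _ => ((hZ y).2 s).continuousAt.continuousWithinAt)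
      (fun s _ => ((hZ y).2 s).hasDerivWithinAt) ?_ t ⟨ht, le_rfl⟩
    rw [(hZ x).1, (hZ y).1]
  rcases le_total 0 t with ht | ht
  · exact nonneg b X hb hX t ht
  · simpa using nonneg _ _ hb.neg hX.neg (-t) (by linarith)

theorem IsFlowOf.continuous_time (hX : IsFlowOf b X) (x : Fin d → ℝ) :
    Continuous fun t => X t x :=
  continuous_iff_continuousAt.2 fun t => ((hX x).2 t).continuousAt

theorem IsFlowOf.lipschitzWith_time (hX : IsFlowOf b X) {M : NNReal} (hM : ∀ y, ‖b y‖ ≤ M)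
    (x : Fin d → ℝ) : LipschitzWith M fun t => X t x := by
  refine lipschitzWith_of_nnnorm_deriv_le (fun t => ((hX x).2 t).differentiableAt) fun t => ?_
  rw [((hX x).2 t).deriv]
  exact hM _

theorem ZdPeriodic.comp_flow {K : NNReal} {E : Type*} {f : (Fin d → ℝ) → E} (hf : ZdPeriodic f)
    (hX : IsFlowOf b X) (hb : LipschitzWith K b) (hper : ZdPeriodic b) (t : ℝ) :
    ZdPeriodic fun y => f (X t y) :=
  fun κ x => by simp only [hX.map_add_int hb hper, hf κ]

end Flows

section InvariantVolume

variable {d : ℕ}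

theorem integrable_and_integral_fderiv_eq_zero {g : (Fin d → ℝ) → ℝ} {K : NNReal}
    (hg : LipschitzWith K g) (hper : ZdPeriodic g) (v : Fin d → ℝ) :
    IntegrableOn (fun y => fderiv ℝ g y v) (unitCube d) ∧
      ∫ y in unitCube d, fderiv ℝ g y v = 0 := by
  obtain ⟨C, -, hC⟩ := hper.exists_norm_le hg.continuous
  have key := hasDerivAt_integral_of_dominated_loc_of_lip
    (μ := (volume : Measure (Fin d → ℝ)).restrict (unitCube d))
    (F := fun (h : ℝ) y => g (y + h • v)) (F' := fun y => fderiv ℝ g y v) (x₀ := 0)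
    (bound := fun _ => (K * ‖v‖₊ : NNReal)) Filter.univ_mem
    (Eventually.of_forall fun h =>
      (hg.continuous.comp (continuous_id.add continuous_const)).aestronglyMeasurable)
    (Integrable.of_bound (hg.continuous.comp
      (continuous_id.add continuous_const)).aestronglyMeasurable C
      (Eventually.of_forall fun y => hC _))
    (measurable_fderiv_apply_const ℝ g v).aestronglyMeasurable
    (Eventually.of_forall fun y => ?_) (integrable_const _) ?_
  · refine ⟨key.1, ?_⟩
    have hconst : (fun h : ℝ => ∫ y in unitCube d, g (y + h • v)) =
        fun _ => ∫ y in unitCube d, g y := by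
      ext h
      exact hper.setIntegral_add_right _
    have h2 := key.2
    rw [hconst] at h2
    exact h2.unique (hasDerivAt_const _ _)
  · refine LipschitzWith.lipschitzOnWith (LipschitzWith.of_dist_le_mul fun s t => ?_)
    refine (hg.dist_le_mul _ _).trans ?_
    rw [dist_add_left, dist_eq_norm, ← sub_smul, norm_smul, dist_eq_norm]
    rw [Real.coe_nnabs, NNReal.abs_eq, NNReal.coe_mul, coe_nnnorm]
    apply le_of_eq
    ring
  · filter_upwards [ae_restrict_of_ae hg.ae_differentiableAt] with y hy
    have h1 : HasFDerivAt g (fderiv ℝ g y) (y + (0 : ℝ) • v) := by simpa using hy.hasFDerivAt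
    have h2 : HasDerivAt (fun h : ℝ => y + h • v) v 0 := by
      simpa using ((hasDerivAt_id (0 : ℝ)).smul_const v).const_add y
    exact h1.comp_hasDerivAt (0 : ℝ) h2

/-- Integration by parts on the torus against a divergence free vector field. -/
theorem integral_fderiv_apply_eq_zero_of_div_eq_zero {u : (Fin d → ℝ) → ℝ} {K : NNReal}
    (hu : LipschitzWith K u) (huper : ZdPeriodic u) {w : (Fin d → ℝ) → (Fin d → ℝ)}
    (hw : ContDiff ℝ 1 w) (hwper : ZdPeriodic w)
    (hdiv : ∀ y, ∑ i : Fin d, fderiv ℝ (fun z => w z i) y (Pi.single i 1) = 0) :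
    ∫ y in unitCube d, fderiv ℝ u y (w y) = 0 := by
  have hwi : ∀ i, ContDiff ℝ 1 fun z => w z i := fun i => contDiff_pi.1 hw i
  have key : ∀ i, IntegrableOn (fun y => fderiv ℝ (fun z => u z * w z i) y (Pi.single i 1))
      (unitCube d) ∧
      ∫ y in unitCube d, fderiv ℝ (fun z => u z * w z i) y (Pi.single i 1) = 0 := by
    intro i
    obtain ⟨Ki, hKi⟩ := (hwper.apply i).exists_lipschitzWith (hwi i)
    obtain ⟨C, -, hC⟩ := huper.exists_norm_le hu.continuous
    obtain ⟨C', -, hC'⟩ := (hwper.apply i).exists_norm_le hKi.continuous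
    obtain ⟨L, hL⟩ := lipschitzWith_mul_of_bounded hu hKi hC hC'
    exact integrable_and_integral_fderiv_eq_zero hL (huper.mul (hwper.apply i)) _
  calc ∫ y in unitCube d, fderiv ℝ u y (w y)
      = ∫ y in unitCube d, ∑ i, fderiv ℝ (fun z => u z * w z i) y (Pi.single i 1) := by
        refine integral_congr_ae ?_
        filter_upwards [ae_restrict_of_ae hu.ae_differentiableAt] with y hy
        have : ∀ i, fderiv ℝ (fun z => u z * w z i) y (Pi.single i 1) =
            u y * fderiv ℝ (fun z => w z i) y (Pi.single i 1) +
              w y i * fderiv ℝ u y (Pi.single i 1) := fun i => by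
          rw [fderiv_fun_mul hy ((hwi i).differentiable one_ne_zero y)]
          simp
        simp only [this, Finset.sum_add_distrib, ← Finset.mul_sum, hdiv, mul_zero, zero_add]
        conv_lhs => rw [pi_eq_sum_univ' (w y)]
        simp [map_sum]
    _ = 0 := by
        rw [integral_finsetSum _ fun i _ => (key i).1]
        exact Finset.sum_eq_zero fun i _ => (key i).2

/-- Every continuous periodic function is a pointwise limit of uniformly bounded Lipschitz
periodic functions. -/
theorem ZdPeriodic.exists_lipschitz_approx {ψ : (Fin d → ℝ) → ℝ} (hper : ZdPeriodic ψ)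
    (hψ : Continuous ψ) : ∃ (C : ℝ) (Ψ : ℕ → (Fin d → ℝ) → ℝ),
      (∀ n, ∃ K, LipschitzWith K (Ψ n)) ∧ (∀ n, ZdPeriodic (Ψ n)) ∧ (∀ n y, ‖Ψ n y‖ ≤ C) ∧
      ∀ y, Tendsto (fun n => Ψ n y) atTop (nhds (ψ y)) := by
  obtain ⟨C, hC0, hC⟩ := hper.exists_norm_le hψ
  let φ : ℕ → ContDiffBump (0 : Fin d → ℝ) := fun n =>
    ⟨1 / (2 * ((n : ℝ) + 1)), 1 / ((n : ℝ) + 1), by positivity,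
      one_div_lt_one_div_of_lt (by positivity) (by linarith [n.cast_nonneg (α := ℝ)])⟩
  let Ψ : ℕ → (Fin d → ℝ) → ℝ := fun n =>
    convolution ((φ n).normed volume) ψ (ContinuousLinearMap.lsmul ℝ ℝ) volume
  have hΨper : ∀ n, ZdPeriodic (Ψ n) := fun n κ x => by
    simp only [Ψ, convolution_def]
    congr 1
    ext t
    rw [add_sub_right_comm, hper κ]
  refine ⟨3 * C, Ψ, fun n => (hΨper n).exists_lipschitzWith ?_, hΨper, fun n y => ?_, fun y => ?_⟩
  · exact (φ n).hasCompactSupport_normed.contDiff_convolution_left _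
      ((φ n).contDiff_normed) hψ.locallyIntegrable
  · have h := (φ n).dist_normed_convolution_le (μ := volume) (x₀ := y) (ε := 2 * C)
      hψ.aestronglyMeasurable
      (fun x _ => by
        rw [dist_eq_norm]
        exact (norm_sub_le _ _).trans (by linarith [hC x, hC y]))
    rw [dist_eq_norm] at h
    have := norm_add_le (Ψ n y - ψ y) (ψ y)
    rw [sub_add_cancel] at this
    linarith [hC y]
  · exact ContDiffBump.convolution_tendsto_right_of_continuous
      (tendsto_one_div_add_atTop_nhds_zero_nat (𝕜 := ℝ)) hψ y

/-- **Liouville's theorem** on the torus: if `m • b` is divergence free then the density `m` is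
invariant under the flow of `b`. -/
theorem IsFlowOf.integral_comp_mul_eq {b : (Fin d → ℝ) → (Fin d → ℝ)}
    {X : ℝ → (Fin d → ℝ) → (Fin d → ℝ)} {K : NNReal} (hX : IsFlowOf b X)
    (hb : LipschitzWith K b) (hper : ZdPeriodic b) {m : (Fin d → ℝ) → ℝ}
    (hm : Continuous m) (hmper : ZdPeriodic m)
    (hw : ContDiff ℝ 1 fun y => m y • b y)
    (hdiv : ∀ y, ∑ i : Fin d, fderiv ℝ (fun z => m z * b z i) y (Pi.single i 1) = 0)
    {ψ : (Fin d → ℝ) → ℝ} (hψ : Continuous ψ) (hψper : ZdPeriodic ψ) (t : ℝ) :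
    ∫ y in unitCube d, ψ (X t y) * m y = ∫ y in unitCube d, ψ y * m y := by
  obtain ⟨M, hM0, hM⟩ := hper.exists_norm_le hb.continuous
  obtain ⟨A, hA0, hA⟩ := hmper.exists_norm_le hm
  have hcont : ∀ t, Continuous (X t) := fun t => (hX.lipschitzWith hb t).choose_spec.continuous
  have lip : ∀ u : (Fin d → ℝ) → ℝ, (∃ L, LipschitzWith L u) → ZdPeriodic u →
      ∫ y in unitCube d, u (X t y) * m y = ∫ y in unitCube d, u y * m y := by
    rintro u ⟨L, hL⟩ huper
    have hderiv : ∀ s : ℝ, HasDerivAt (fun r => ∫ y in unitCube d, u (X r y) * m y) 0 s := by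
      intro s
      obtain ⟨Ls, hLs⟩ := hX.lipschitzWith hb s
      have hus : LipschitzWith (L * Ls) fun z => u (X s z) := hL.comp hLs
      have husper : ZdPeriodic fun y => u (X s y) := huper.comp_flow hX hb hper s
      obtain ⟨B, -, hB⟩ := huper.exists_norm_le hL.continuous
      have hmeas : ∀ r, AEStronglyMeasurable (fun y => u (X r y) * m y)
          (volume.restrict (unitCube d)) := fun r =>
        ((hL.continuous.comp (hcont r)).mul hm).aestronglyMeasurable
      have key := hasDerivAt_integral_of_dominated_loc_of_lip
        (μ := (volume : Measure (Fin d → ℝ)).restrict (unitCube d))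
        (F := fun (r : ℝ) y => u (X r y) * m y)
        (F' := fun y => fderiv ℝ (fun z => u (X s z)) y (m y • b y)) (x₀ := s)
        (bound := fun _ => (L * M.toNNReal * A.toNNReal : NNReal)) Filter.univ_mem
        (Eventually.of_forall fun r => hmeas r)
        (Integrable.of_bound (hmeas s) (B * A) (Eventually.of_forall fun y => by
          rw [norm_mul]
          exact mul_le_mul (hB _) (hA _) (norm_nonneg _) ((norm_nonneg _).trans (hB 0))))
        ?_ (Eventually.of_forall fun y => ?_) (integrable_const _) ?_
      · rw [integral_fderiv_apply_eq_zero_of_div_eq_zero hus husper hw (hmper.smul hper)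
          (by simpa using hdiv)] at key
        exact key.2
      · have h : ∀ y, fderiv ℝ (fun z => u (X s z)) y (m y • b y) =
            ∑ i, (m y • b y) i * fderiv ℝ (fun z => u (X s z)) y (Pi.single i 1) := fun y => by
          conv_lhs => rw [pi_eq_sum_univ' (m y • b y)]
          simp [map_sum]
        simp only [h]
        exact (Finset.measurable_sum _ fun i _ => (contDiff_pi.1 hw i).continuous.measurable.mul
          (measurable_fderiv_apply_const ℝ _ _)).aestronglyMeasurable
      · refine LipschitzWith.lipschitzOnWith (LipschitzWith.of_dist_le_mul fun r r' => ?_)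
        have h1 := (hL.comp (hX.lipschitzWith_time (M := M.toNNReal)
          (fun y => (hM y).trans (Real.le_coe_toNNReal _)) y)).dist_le_mul r r'
        simp only [Function.comp_def] at h1
        rw [Real.dist_eq, ← sub_mul, abs_mul, ← Real.dist_eq]
        have h2 : |m y| ≤ A.toNNReal := (hA y).trans (Real.le_coe_toNNReal _)
        calc _ ≤ ((L * M.toNNReal : NNReal) : ℝ) * dist r r' * A.toNNReal := by gcongr
          _ = _ := by
            rw [Real.coe_nnabs, NNReal.abs_eq]
            push_cast
            ring
      · filter_upwards [ae_restrict_of_ae hus.ae_differentiableAt] with y hy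
        have h1 : HasFDerivAt (fun z => u (X s z)) (fderiv ℝ (fun z => u (X s z)) y)
            (X (s - s) y) := by
          rw [sub_self, (hX y).1]; exact hy.hasFDerivAt
        have h2 : HasDerivAt (fun r => X (r - s) y) (b y) s := by
          have := ((hX y).2 (s - s)).comp_sub_const s s
          rwa [sub_self, (hX y).1] at this
        have h3 := (h1.comp_hasDerivAt s h2).mul_const (m y)
        have h4 : (fun r => u (X s (X (r - s) y)) * m y) = fun r => u (X r y) * m y := by
          ext r
          rw [← hX.map_add hb, add_sub_cancel]
        rw [map_smul, smul_eq_mul, mul_comm, ← h4]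
        exact h3
    have := is_const_of_deriv_eq_zero (fun s => (hderiv s).differentiableAt)
      (fun s => (hderiv s).deriv) t 0
    simpa only [(hX _).1] using this
  obtain ⟨C, Ψ, hΨlip, hΨper, hΨC, hΨ⟩ := hψper.exists_lipschitz_approx hψ
  have limit : ∀ r, Tendsto (fun n => ∫ y in unitCube d, Ψ n (X r y) * m y) atTop
      (nhds (∫ y in unitCube d, ψ (X r y) * m y)) := fun r => by
    refine tendsto_integral_of_dominated_convergence (fun _ => C * A) (fun n => ?_)
      (integrable_const _) (fun n => Eventually.of_forall fun y => ?_)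
      (Eventually.of_forall fun y => (hΨ (X r y)).mul_const _)
    · exact (((hΨlip n).choose_spec.continuous.comp (hcont r)).mul hm).aestronglyMeasurable
    · rw [norm_mul]
      exact mul_le_mul (hΨC _ _) (hA _) (norm_nonneg _) ((norm_nonneg _).trans (hΨC 0 0))
  have h0 := limit 0
  simp only [(hX _).1] at h0
  refine tendsto_nhds_unique (limit t) ?_
  simpa only [lip _ (hΨlip _) (hΨper _)] using h0

end InvariantVolume

section KrylovBogoliubov

variable {d : ℕ}

/-- The canonical projection of `ℝ^d` onto the torus, as a product of circles. -/
def toTorus (d : ℕ) : (Fin d → ℝ) → (Fin d → UnitAddCircle) :=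
  Pi.map fun _ x => (x : UnitAddCircle)

/-- The section of `toTorus` with values in the unit cube. -/
def ofTorus (d : ℕ) (z : Fin d → UnitAddCircle) : Fin d → ℝ :=
  fun i => AddCircle.measurableEquivIco 1 0 (z i)

theorem isQuotientMap_toTorus (d : ℕ) : Topology.IsQuotientMap (toTorus d) :=
  (IsOpenQuotientMap.piMap fun _ => QuotientAddGroup.isOpenQuotientMap_mk).isQuotientMap

theorem measurable_ofTorus (d : ℕ) : Measurable (ofTorus d) :=
  measurable_pi_lambda _ fun i =>
    measurable_subtype_coe.comp ((AddCircle.measurableEquivIco 1 0).measurable.comp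
      (measurable_pi_apply i))

theorem ofTorus_mem_unitCube (z : Fin d → UnitAddCircle) : ofTorus d z ∈ unitCube d := fun i => by
  simpa [ofTorus] using (AddCircle.measurableEquivIco 1 0 (z i)).2

theorem toTorus_ofTorus (z : Fin d → UnitAddCircle) : toTorus d (ofTorus d z) = z :=
  funext fun i => (AddCircle.equivIco 1 0).symm_apply_apply (z i)

theorem ZdPeriodic.apply_ofTorus_toTorus {E : Type*} {f : (Fin d → ℝ) → E} (hf : ZdPeriodic f)
    (x : Fin d → ℝ) : f (ofTorus d (toTorus d x)) = f x := by
  have h : ∀ i, ∃ n : ℤ, x i + n = ofTorus d (toTorus d x) i := fun i => by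
    have h1 : ((x i : ℝ) : UnitAddCircle) = (ofTorus d (toTorus d x) i : ℝ) :=
      (congrFun (toTorus_ofTorus (toTorus d x)) i).symm
    obtain ⟨n, hn⟩ := AddSubgroup.mem_zmultiples_iff.1 (QuotientAddGroup.eq.1 h1)
    refine ⟨n, ?_⟩
    rw [zsmul_one] at hn
    linarith
  choose κ hκ using h
  rw [← hf κ x]
  congr 1
  ext i
  exact (hκ i).symm

theorem ZdPeriodic.continuous_comp_ofTorus {f : (Fin d → ℝ) → ℝ} (hf : ZdPeriodic f)
    (hc : Continuous f) : Continuous fun z => f (ofTorus d z) := by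
  rw [(isQuotientMap_toTorus d).continuous_iff]
  simpa only [Function.comp_def, hf.apply_ofTorus_toTorus] using hc

/-- Along every ultrafilter, the time averages over a continuous curve converge to the integral
against a probability measure on the torus. -/
theorem exists_measure_tendsto_average (γ : ℝ → (Fin d → ℝ)) (hγ : Continuous γ)
    (g : Ultrafilter ℝ) : ∃ μ : Measure (Fin d → ℝ), IsProbabilityMeasure μ ∧
      μ (unitCube d)ᶜ = 0 ∧ ∀ ψ : (Fin d → ℝ) → ℝ, Continuous ψ → ZdPeriodic ψ →
        Tendsto (fun t : ℝ => ∫ s in (0 : ℝ)..1, ψ (γ (t * s))) g (nhds (∫ y, ψ y ∂μ)) := by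
  have hπ := (isQuotientMap_toTorus d).continuous
  have hcurve : ∀ t : ℝ, Continuous fun s => toTorus d (γ (t * s)) := fun t =>
    hπ.comp (hγ.comp (continuous_const.mul continuous_id))
  let P₀ : Measure ℝ := volume.restrict (Set.Ioc 0 1)
  have hprob : IsProbabilityMeasure P₀ := ⟨by simp [P₀]⟩
  let P : ℝ → ProbabilityMeasure (Fin d → UnitAddCircle) := fun t =>
    ⟨P₀.map fun s => toTorus d (γ (t * s)),
      Measure.isProbabilityMeasure_map (hcurve t).measurable.aemeasurable⟩
  obtain ⟨ν, -, hν⟩ := isCompact_univ.ultrafilter_le_nhds (g.map P) (by simp)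
  have hν' : Tendsto P g (nhds ν) := hν
  rw [ProbabilityMeasure.tendsto_iff_forall_integral_tendsto] at hν'
  refine ⟨(ν : Measure _).map (ofTorus d),
    Measure.isProbabilityMeasure_map (measurable_ofTorus d).aemeasurable, ?_, fun ψ hψ hper => ?_⟩
  · rw [Measure.map_apply (measurable_ofTorus d) (measurableSet_unitCube d).compl]
    convert! measure_empty (μ := (ν : Measure (Fin d → UnitAddCircle)))
    ext z
    simpa using ofTorus_mem_unitCube z
  · have h := hν' (BoundedContinuousFunction.mkOfCompact
      ⟨fun z => ψ (ofTorus d z), hper.continuous_comp_ofTorus hψ⟩)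
    rw [integral_map (measurable_ofTorus d).aemeasurable hψ.aestronglyMeasurable]
    refine h.congr fun t => ?_
    have h1 := integral_map (μ := P₀) (hcurve t).measurable.aemeasurable
      (hper.continuous_comp_ofTorus hψ).aestronglyMeasurable
    simp only [hper.apply_ofTorus_toTorus] at h1
    rw [intervalIntegral.integral_of_le zero_le_one]
    exact h1

theorem abs_integral_comp_mul_add_sub_le {h : ℝ → ℝ} (hh : Continuous h) {C : ℝ}
    (hC : ∀ s, ‖h s‖ ≤ C) (τ : ℝ) {t : ℝ} (ht : 0 < t) :
    |(∫ s in (0 : ℝ)..1, h (t * s + τ)) - ∫ s in (0 : ℝ)..1, h (t * s)| ≤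
      2 * C * |τ| * t⁻¹ := by
  have hi : ∀ a b : ℝ, IntervalIntegrable h volume a b := fun a b => hh.intervalIntegrable a b
  have e : (∫ s in (0 : ℝ)..1, h (t * s + τ)) - ∫ s in (0 : ℝ)..1, h (t * s) =
      t⁻¹ * ((∫ s in t..(t + τ), h s) - ∫ s in (0 : ℝ)..τ, h s) := by
    rw [intervalIntegral.integral_comp_mul_add h ht.ne',
      intervalIntegral.integral_comp_mul_left h ht.ne',
      smul_eq_mul, smul_eq_mul, ← mul_sub]
    simp only [mul_zero, mul_one, zero_add]
    rw [intervalIntegral.integral_interval_sub_interval_comm' (hi _ _) (hi _ _) (hi _ _)]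
  have b1 := intervalIntegral.norm_integral_le_of_norm_le_const (a := t) (b := t + τ)
    fun s _ => hC s
  have b2 := intervalIntegral.norm_integral_le_of_norm_le_const (a := 0) (b := τ)
    fun s _ => hC s
  rw [Real.norm_eq_abs] at b1 b2
  rw [e, abs_mul, abs_of_pos (inv_pos.2 ht), mul_comm]
  gcongr
  refine (abs_sub _ _).trans ?_
  simp only [add_sub_cancel_left, sub_zero] at b1 b2
  linarith

/-- If the rotation set is a singleton, it gives the asymptotics of every trajectory. -/
theorem IsFlowOf.tendsto_of_rotationSet_eq_singleton {b : (Fin d → ℝ) → (Fin d → ℝ)}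
    {X : ℝ → (Fin d → ℝ) → (Fin d → ℝ)} {K : NNReal} (hX : IsFlowOf b X)
    (hb : LipschitzWith K b) (hper : ZdPeriodic b) {ζ : Fin d → ℝ}
    (hζ : rotationSet b X = {ζ}) (x : Fin d → ℝ) :
    Tendsto (fun t : ℝ => t⁻¹ • X t x) atTop (nhds ζ) := by
  rw [tendsto_iff_ultrafilter]
  intro g hg
  obtain ⟨μ, hμ, hμc, hlim⟩ := exists_measure_tendsto_average (fun t => X t x)
    (hX.continuous_time x) g
  have hinv : FlowInvariant X μ := by
    intro τ ψ hψ hψper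
    obtain ⟨L, hL⟩ := hX.lipschitzWith hb τ
    obtain ⟨C, -, hC⟩ := hψper.exists_norm_le hψ
    have h1 := hlim (fun y => ψ (X τ y)) (hψ.comp hL.continuous) (hψper.comp_flow hX hb hper τ)
    have h2 := hlim ψ hψ hψper
    simp only [← hX.map_add hb, add_comm τ] at h1
    have h3 : Tendsto (fun t : ℝ => 2 * C * |τ| * t⁻¹) g (nhds 0) := by
      simpa using (tendsto_inv_atTop_zero.mono_left hg).const_mul (2 * C * |τ|)
    have h4 := squeeze_zero_norm' (f := fun t : ℝ => (∫ s in (0 : ℝ)..1, ψ (X (t * s + τ) x)) -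
        ∫ s in (0 : ℝ)..1, ψ (X (t * s) x))
      ((eventually_gt_atTop (0 : ℝ)).filter_mono hg |>.mono fun t ht =>
        abs_integral_comp_mul_add_sub_le (hψ.comp (hX.continuous_time x))
          (fun s => hC _) τ ht) h3
    exact sub_eq_zero.1 (tendsto_nhds_unique (h1.sub h2) h4)
  have hmem : (∫ y, b y ∂μ) ∈ rotationSet b X := ⟨μ, hμ, hμc, hinv, rfl⟩
  rw [hζ, Set.mem_singleton_iff] at hmem
  obtain ⟨M, -, hM⟩ := hper.exists_norm_le hb.continuous
  have hint : Integrable b μ := Integrable.of_bound hb.continuous.aestronglyMeasurable M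
    (Eventually.of_forall hM)
  rw [← hmem, tendsto_pi_nhds]
  intro i
  have hbi : Continuous fun y => b y i := (continuous_apply i).comp hb.continuous
  rw [eval_integral fun i => hint.eval i]
  have h1 := hlim (fun y => b y i) hbi (hper.apply i)
  have h2 : Tendsto (fun t : ℝ => t⁻¹ * x i) g (nhds 0) := by
    simpa using (tendsto_inv_atTop_zero.mono_left hg).mul_const (x i)
  have h3 := h2.add h1
  rw [zero_add] at h3
  refine h3.congr' ((eventually_gt_atTop (0 : ℝ)).filter_mono hg |>.mono fun t ht => ?_)
  have hder : ∀ s ∈ Set.uIcc 0 t, HasDerivAt (fun s => X s x i) (b (X s x) i) s := fun s _ =>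
    hasDerivAt_pi.1 ((hX x).2 s) i
  have hftc := intervalIntegral.integral_eq_sub_of_hasDerivAt hder
    ((hbi.comp (hX.continuous_time x)).intervalIntegrable _ _)
  rw [intervalIntegral.integral_comp_mul_left (fun s => b (X s x) i) ht.ne', mul_zero, mul_one,
    hftc, (hX x).1]
  simp only [Pi.smul_apply, smul_eq_mul]
  ring

end KrylovBogoliubov

section TimeChange

variable {d : ℕ}

/-- Trajectories of a slowed-down field are slowed-down trajectories. -/
theorem IsFlowOf.exists_time_change {r r₁ : (Fin d → ℝ) → ℝ} {Φ : (Fin d → ℝ) → (Fin d → ℝ)}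
    {X X₁ : ℝ → (Fin d → ℝ) → (Fin d → ℝ)} {K : NNReal}
    (hX : IsFlowOf (fun y => r y • Φ y) X) (hX₁ : IsFlowOf (fun y => r₁ y • Φ y) X₁)
    (hK : LipschitzWith K fun y => r₁ y • Φ y) (hr : Continuous r) (hr₁ : Continuous r₁)
    (h0 : ∀ y, 0 ≤ r y) (hpos : ∀ y, 0 < r₁ y) (hle : ∀ y, r y ≤ r₁ y) (x : Fin d → ℝ)
    {t : ℝ} (ht : 0 ≤ t) : ∃ s ∈ Set.Icc 0 t, X t x = X₁ s x := by
  let q : ℝ → ℝ := fun s => r (X s x) / r₁ (X s x)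
  have hq : Continuous q := (hr.comp (hX.continuous_time x)).div
    (hr₁.comp (hX.continuous_time x)) fun s => (hpos _).ne'
  have hq0 : ∀ s, 0 ≤ q s := fun s => div_nonneg (h0 _) (hpos _).le
  have hq1 : ∀ s, q s ≤ 1 := fun s => div_le_one_of_le₀ (hle _) (hpos _).le
  let τ : ℝ → ℝ := fun s => ∫ a in (0 : ℝ)..s, q a
  have hτ : ∀ s, HasDerivAt τ (q s) s := fun s => hq.integral_hasStrictDerivAt 0 s |>.hasDerivAt
  have heq : (fun s => X s x) = fun s => X₁ (τ s) x := by
    refine ODE_solution_unique_univ (v := fun s y => q s • r₁ y • Φ y)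
      (s := fun _ => Set.univ) (K := K) (t₀ := 0)
      (fun s => LipschitzWith.lipschitzOnWith (LipschitzWith.of_dist_le_mul fun y z => ?_))
      (fun s => ⟨?_, trivial⟩) (fun s => ⟨?_, trivial⟩) ?_
    · rw [dist_smul₀, Real.norm_of_nonneg (hq0 s)]
      exact (mul_le_of_le_one_left dist_nonneg (hq1 s)).trans (hK.dist_le_mul y z)
    · have : q s • r₁ (X s x) • Φ (X s x) = r (X s x) • Φ (X s x) := by
        rw [smul_smul, div_mul_cancel₀ _ (hpos _).ne']
      rw [this]
      exact (hX x).2 s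
    · exact ((hX₁ x).2 (τ s)).scomp s (hτ s)
    · simp [τ, (hX x).1, (hX₁ x).1]
  refine ⟨τ t, ⟨intervalIntegral.integral_nonneg ht fun s _ => hq0 s, ?_⟩, congrFun heq t⟩
  calc τ t ≤ ∫ _ in (0 : ℝ)..t, (1 : ℝ) :=
        intervalIntegral.integral_mono_on ht (hq.intervalIntegrable _ _)
          intervalIntegrable_const fun s _ => hq1 s
    _ = t := by simp

theorem integral_mem_rotationSet {b : (Fin d → ℝ) → (Fin d → ℝ)}
    {X : ℝ → (Fin d → ℝ) → (Fin d → ℝ)} {K : NNReal} (hX : IsFlowOf b X)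
    (hb : LipschitzWith K b) (hper : ZdPeriodic b) {p : (Fin d → ℝ) → ℝ}
    (hp : Continuous p) (hpper : ZdPeriodic p) (hp0 : ∀ y, 0 ≤ p y)
    (hp1 : ∫ y in unitCube d, p y = 1) (hw : ContDiff ℝ 1 fun y => p y • b y)
    (hdiv : ∀ y, ∑ i : Fin d, fderiv ℝ (fun z => p z * b z i) y (Pi.single i 1) = 0) :
    ∫ y in unitCube d, p y • b y ∈ rotationSet b X := by
  obtain ⟨A, -, hA⟩ := hpper.exists_norm_le hp
  have hpint : IntegrableOn p (unitCube d) := Integrable.of_bound hp.aestronglyMeasurable A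
    (Eventually.of_forall hA)
  have hpm : Measurable fun y => ENNReal.ofReal (p y) := hp.measurable.ennreal_ofReal
  let μ : Measure (Fin d → ℝ) :=
    (volume.restrict (unitCube d)).withDensity fun y => ENNReal.ofReal (p y)
  have hμ : ∀ {E : Type} [NormedAddCommGroup E] [NormedSpace ℝ E] (f : (Fin d → ℝ) → E),
      ∫ y, f y ∂μ = ∫ y in unitCube d, p y • f y := fun f => by
    rw [integral_withDensity_eq_integral_toReal_smul hpm
      (Eventually.of_forall fun _ => ENNReal.ofReal_lt_top)]
    simp only [ENNReal.toReal_ofReal (hp0 _)]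
  refine ⟨μ, ⟨?_⟩, ?_, fun t ψ hψ hψper => ?_, (hμ b).symm⟩
  · rw [withDensity_apply _ MeasurableSet.univ, Measure.restrict_univ,
      ← ofReal_integral_eq_lintegral_ofReal hpint (Eventually.of_forall hp0), hp1,
      ENNReal.ofReal_one]
  · refine withDensity_absolutelyContinuous _ _ ?_
    rw [Measure.restrict_apply (measurableSet_unitCube d).compl, Set.compl_inter_self,
      measure_empty]
  · rw [hμ, hμ]
    simpa only [smul_eq_mul, mul_comm] using
      hX.integral_comp_mul_eq hb hper hp hpper hw hdiv hψ hψper t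

/-- The rotation vector of `r • Φ` is controlled by the harmonic mean of `r / σ`. -/
theorem norm_le_of_rotationSet_eq_singleton {r σ : (Fin d → ℝ) → ℝ}
    {Φ : (Fin d → ℝ) → (Fin d → ℝ)} {X : ℝ → (Fin d → ℝ) → (Fin d → ℝ)} {K : NNReal}
    (hX : IsFlowOf (fun y => r y • Φ y) X) (hK : LipschitzWith K fun y => r y • Φ y)
    (hr : Continuous r) (hrper : ZdPeriodic r) (hpos : ∀ y, 0 < r y)
    (hΦ : ContDiff ℝ 1 Φ) (hΦper : ZdPeriodic Φ)
    (hσ : ContDiff ℝ 1 σ) (hσper : ZdPeriodic σ) (hσpos : ∀ y, 0 < σ y)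
    (hdiv : ∀ y : Fin d → ℝ,
      ∑ i : Fin d, fderiv ℝ (fun z => σ z * Φ z i) y (Pi.single i 1) = 0)
    {C : ℝ} (hC : ∀ y, ‖σ y • Φ y‖ ≤ C) {ζ : Fin d → ℝ}
    (hζ : rotationSet (fun y => r y • Φ y) X = {ζ})
    (hI : 0 < ∫ y in unitCube d, σ y / r y) :
    ‖ζ‖ ≤ (∫ y in unitCube d, σ y / r y)⁻¹ * C := by
  set I := ∫ y in unitCube d, σ y / r y with hIdef
  have hrew : ∀ y, (I⁻¹ * (σ y / r y)) • r y • Φ y = I⁻¹ • σ y • Φ y := fun y => by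
    rw [smul_smul, smul_smul, mul_assoc, div_mul_cancel₀ _ (hpos y).ne']
  have hmem := integral_mem_rotationSet hX hK (hrper.smul hΦper)
    (p := fun y => I⁻¹ * (σ y / r y))
    (continuous_const.mul (hσ.continuous.div hr fun y => (hpos y).ne'))
    (fun κ y => by simp only [hσper κ, hrper κ])
    (fun y => by have := hpos y; have := hσpos y; positivity)
    (by rw [integral_const_mul, inv_mul_cancel₀ hI.ne'])
    (by
      simp only [hrew]
      exact (hσ.smul hΦ).const_smul I⁻¹)
    (fun y => by
      have h1 : ∀ i z, I⁻¹ * (σ z / r z) * (r z • Φ z) i = I⁻¹ * (σ z * Φ z i) := fun i z =>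
        congrFun (hrew z) i
      have h2 : ∀ i, DifferentiableAt ℝ (fun z => σ z * Φ z i) y := fun i =>
        (hσ.mul (contDiff_pi.1 hΦ i)).differentiable one_ne_zero y
      simp only [h1, fderiv_const_mul (h2 _), _root_.smul_apply, smul_eq_mul,
        ← Finset.mul_sum, hdiv, mul_zero])
  rw [hζ, Set.mem_singleton_iff] at hmem
  simp only [hrew] at hmem
  rw [← hmem, integral_smul, norm_smul, norm_inv, Real.norm_of_nonneg hI.le]
  gcongr
  simpa using norm_integral_le_of_norm_le_const (μ := volume.restrict (unitCube d))
    (Eventually.of_forall hC)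

/-- If the harmonic mean of `ρ / σ` vanishes, those of `ρn n / σ` get arbitrarily small. -/
theorem exists_lt_integral_div {ρ σ : (Fin d → ℝ) → ℝ} {ρn : ℕ → (Fin d → ℝ) → ℝ}
    (hρn : ∀ n, Continuous (ρn n)) (hρnper : ∀ n, ZdPeriodic (ρn n)) (hpos : ∀ n y, 0 < ρn n y)
    (hlim : ∀ y, Tendsto (fun n => ρn n y) atTop (nhds (ρ y)))
    (hσ : Continuous σ) (hσper : ZdPeriodic σ) (hσpos : ∀ y, 0 < σ y)
    (hharm : (∫⁻ y in unitCube d, ENNReal.ofReal (σ y) / ENNReal.ofReal (ρ y)) = ⊤) (R : ℝ) :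
    ∃ n, R < ∫ y in unitCube d, σ y / ρn n y := by
  by_contra! hcon
  have hfatou := lintegral_liminf_le (μ := volume.restrict (unitCube d)) (u := atTop)
    (f := fun n y => ENNReal.ofReal (σ y) / ENNReal.ofReal (ρn n y))
    fun n => hσ.measurable.ennreal_ofReal.div (hρn n).measurable.ennreal_ofReal
  have hl : ∀ y, liminf (fun n => ENNReal.ofReal (σ y) / ENNReal.ofReal (ρn n y)) atTop =
      ENNReal.ofReal (σ y) / ENNReal.ofReal (ρ y) := fun y =>
    (ENNReal.Tendsto.const_div (ENNReal.tendsto_ofReal (hlim y))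
      (Or.inr ENNReal.ofReal_ne_top)).liminf_eq
  have hn : ∀ n, ∫⁻ y in unitCube d, ENNReal.ofReal (σ y) / ENNReal.ofReal (ρn n y) ≤
      ENNReal.ofReal R := fun n => by
    have hc : Continuous fun y => σ y / ρn n y := hσ.div (hρn n) fun y => (hpos n y).ne'
    have hper : ZdPeriodic fun y => σ y / ρn n y := fun κ y => by
      simp only [hσper κ, hρnper n κ]
    obtain ⟨C, -, hC⟩ := hper.exists_norm_le hc
    simp only [← ENNReal.ofReal_div_of_pos (hpos n _)]
    rw [← ofReal_integral_eq_lintegral_ofReal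
      (Integrable.of_bound hc.aestronglyMeasurable C (Eventually.of_forall hC))
      (Eventually.of_forall fun y => (div_pos (hσpos y) (hpos n y)).le)]
    exact ENNReal.ofReal_le_ofReal (hcon n)
  simp only [hl, hharm, top_le_iff] at hfatou
  have := liminf_le_of_le (f := atTop) (u := fun n =>
    ∫⁻ y in unitCube d, ENNReal.ofReal (σ y) / ENNReal.ofReal (ρn n y)) (a := ENNReal.ofReal R)
    (by isBoundedDefault) fun b hb => by
      obtain ⟨n, hbn⟩ := hb.exists
      exact hbn.trans (hn n)
  rw [hfatou] at this
  exact ENNReal.ofReal_ne_top (top_le_iff.1 this)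

end TimeChange

/-- In the setting of the perturbation theorem (with `ρ` vanishing
somewhere), if there is a positive `σ ∈ C¹_♯(Y_d)` with `σΦ` divergence free in `ℝ^d` and the
harmonic mean of `ρ/σ` is `0` (i.e. `∫_{Y_d} σ/ρ dy = ∞`), then `X(t,x)/t → 0` for every
`x ∈ ℝ^d`. -/
theorem flow_null_asymptotics_zero_harmonic_mean {d : ℕ} (hd : 1 ≤ d)
    (ρ : (Fin d → ℝ) → ℝ) (hρ : ContDiff ℝ 1 ρ) (hρper : ZdPeriodic ρ)
    (hρ0 : ∀ y, 0 ≤ ρ y) (hρne : ∃ y, ρ y ≠ 0)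
    (Φ : (Fin d → ℝ) → (Fin d → ℝ)) (hΦ : ContDiff ℝ 1 Φ) (hΦper : ZdPeriodic Φ)
    (hΦne : ∀ y, Φ y ≠ 0)
    (X : ℝ → (Fin d → ℝ) → (Fin d → ℝ)) (hX : IsFlowOf (fun y => ρ y • Φ y) X)
    (ρn : ℕ → (Fin d → ℝ) → ℝ)
    (hρn : ∀ n, ContDiff ℝ 1 (ρn n)) (hρnper : ∀ n, ZdPeriodic (ρn n))
    (hρnpos : ∀ n y, 0 < ρn n y) (hle : ∀ n y, ρ y ≤ ρn n y)
    (hunif : TendstoUniformly ρn ρ atTop)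
    (Xn : ℕ → ℝ → (Fin d → ℝ) → (Fin d → ℝ))
    (hXn : ∀ n, IsFlowOf (fun y => ρn n y • Φ y) (Xn n))
    (hsin : ∀ n, ∃ ζ : Fin d → ℝ, rotationSet (fun y => ρn n y • Φ y) (Xn n) = {ζ})
    (hvan : ∃ x₀, ρ x₀ = 0)
    (σ : (Fin d → ℝ) → ℝ) (hσ : ContDiff ℝ 1 σ) (hσper : ZdPeriodic σ) (hσpos : ∀ y, 0 < σ y)
    (hdiv : ∀ y : Fin d → ℝ,
      ∑ i : Fin d, fderiv ℝ (fun z => σ z * Φ z i) y (Pi.single i 1) = 0)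
    (hharm : (∫⁻ y in unitCube d, ENNReal.ofReal (σ y) / ENNReal.ofReal (ρ y)) = ⊤) :
    ∀ x : Fin d → ℝ, Tendsto (fun t : ℝ => t⁻¹ • X t x) atTop (nhds 0) := by
  intro x
  have hconv : ∀ y, Tendsto (fun n => ρn n y) atTop (nhds (ρ y)) := fun y =>
    hunif.tendsto_at y
  obtain ⟨C, hC0, hC⟩ := (hσper.smul hΦper).exists_norm_le (hσ.smul hΦ).continuous
  rw [Metric.tendsto_atTop']
  intro ε hε
  obtain ⟨n, hn⟩ := exists_lt_integral_div (fun n => (hρn n).continuous) hρnper hρnpos hconv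
    hσ.continuous hσper hσpos hharm (4 * C / ε)
  obtain ⟨K, hK⟩ := ((hρnper n).smul hΦper).exists_lipschitzWith ((hρn n).smul hΦ)
  obtain ⟨ζ, hζ⟩ := hsin n
  have hI : 0 < ∫ y in unitCube d, σ y / ρn n y := lt_of_le_of_lt (by positivity) hn
  have hζε : ‖ζ‖ ≤ ε / 4 := by
    refine (norm_le_of_rotationSet_eq_singleton (hXn n) hK (hρn n).continuous (hρnper n)
      (hρnpos n) hΦ hΦper hσ hσper hσpos hdiv hC hζ hI).trans ?_
    rw [inv_mul_le_iff₀ hI]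
    rw [div_lt_iff₀ hε] at hn
    linarith
  have hlim := (hXn n).tendsto_of_rotationSet_eq_singleton hK ((hρnper n).smul hΦper) hζ x
  obtain ⟨S, hS⟩ := (Metric.tendsto_atTop.1 hlim) (ε / 4) (by positivity)
  obtain ⟨A, hA⟩ := (isCompact_Icc (a := (0 : ℝ)) (b := max S 1)).exists_bound_of_continuousOn
    ((hXn n).continuous_time x).continuousOn
  have hbound : ∀ s, 0 ≤ s → ‖Xn n s x‖ ≤ ε / 2 * s + |A| := by
    intro s hs
    rcases le_total s (max S 1) with h | h
    · have := hA s ⟨hs, h⟩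
      have h2 : 0 ≤ ε / 2 * s := by positivity
      linarith [le_abs_self A]
    · have hs0 : 0 < s := lt_of_lt_of_le one_pos ((le_max_right _ _).trans h)
      have h1 := hS s ((le_max_left _ _).trans h)
      rw [dist_eq_norm] at h1
      have h2 : ‖s⁻¹ • Xn n s x‖ ≤ ε / 2 := by
        have := norm_add_le (s⁻¹ • Xn n s x - ζ) ζ
        rw [sub_add_cancel] at this
        linarith
      rw [norm_smul, norm_inv, Real.norm_of_nonneg hs, inv_mul_le_iff₀ hs0] at h2
      linarith [abs_nonneg A]
  refine ⟨max 0 (4 * |A| / ε), fun t ht => ?_⟩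
  have ht0 : 0 < t := (le_max_left _ _).trans_lt ht
  have htA : 4 * |A| / ε < t := (le_max_right _ _).trans_lt ht
  obtain ⟨s, ⟨hs0, hst⟩, hs⟩ := hX.exists_time_change (hXn n) hK hρ.continuous
    (hρn n).continuous hρ0 (hρnpos n) (hle n) x ht0.le
  rw [dist_zero_right, norm_smul, norm_inv, Real.norm_of_nonneg ht0.le, inv_mul_lt_iff₀ ht0, hs]
  rw [div_lt_iff₀ hε] at htA
  have h1 := hbound s hs0
  have h2 : ε / 2 * s ≤ ε / 2 * t := by gcongr
  nlinarith [mul_pos hε ht0]
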